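/- Suppose that a group G is finitely presented relative to a collection of subgroups {H_λ}_{λ∈Λ} and that the relative Dehn function δ^rel of G with respect to {H_λ}_{λ∈Λ} is well-defined. Then δ^rel is subquadratic (i.e. δ^rel(n) = o(n²) as n → ∞) if and only if δ^rel is linear. -/

import Mathlib

namespace RelHyp

variable {G : Type*} [Group G] {Λ : Type*}

/-- Length of a shortest word over the alphabet `S ∪ S⁻¹` representing `g`. -/
noncomputable def wordLength (S : Set G) (g : G) : ℕ :=
  sInf {n | ∃ w : List G, w.length = n ∧ (∀ x ∈ w, x ∈ S ∨ x⁻¹ ∈ S) ∧ w.prod = g}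

/-- The free product `F = (∗_λ H_λ) ∗ F(X)`. -/
abbrev RelFree (H : Λ → Subgroup G) (X : Set G) : Type _ :=
  Monoid.Coprod (Monoid.CoprodI fun l => ↥(H l)) (FreeGroup ↥X)

/-- The canonical homomorphism `ε : F → G`. -/
def relEps (H : Λ → Subgroup G) (X : Set G) : RelFree H X →* G :=
  Monoid.Coprod.lift (Monoid.CoprodI.lift fun l => (H l).subtype)
    (FreeGroup.lift fun x => (x : G))

/-- Letters of the alphabet `X ∪ 𝓗`, where `𝓗 = ⊔_λ (H̃_λ ∖ {1})`. -/
abbrev RelLetter (H : Λ → Subgroup G) (X : Set G) : Type _ :=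
  (Σ l : Λ, {h : ↥(H l) // h ≠ 1}) ⊕ (↥X × Bool)

/-- The image of a letter in the free product `F`. -/
def RelLetter.toF {H : Λ → Subgroup G} {X : Set G} : RelLetter H X → RelFree H X
  | Sum.inl ⟨_, h⟩ => Monoid.Coprod.inl (Monoid.CoprodI.of h.1)
  | Sum.inr (x, b) => Monoid.Coprod.inr (if b then FreeGroup.of x else (FreeGroup.of x)⁻¹)

/-- The element of `G` represented by a letter. -/
def RelLetter.val {H : Λ → Subgroup G} {X : Set G} : RelLetter H X → G
  | Sum.inl ⟨_, h⟩ => (h.1 : G)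
  | Sum.inr (x, b) => if b then (x : G) else (x : G)⁻¹

/-- The index `λ` such that the letter belongs to `H̃_λ`, if any. -/
def RelLetter.hIndex {H : Λ → Subgroup G} {X : Set G} : RelLetter H X → Option Λ
  | Sum.inl ⟨l, _⟩ => some l
  | Sum.inr _ => none

/-- The element of `F` represented by a word over `X ∪ 𝓗`. -/
def wordToF {H : Λ → Subgroup G} {X : Set G} (w : List (RelLetter H X)) : RelFree H X :=
  (w.map RelLetter.toF).prod

/-- `f` is a relative isoperimetric function of the relative presentation `⟨X, H | R⟩`. -/
def IsIsoperFn (H : Λ → Subgroup G) (X : Set G) (R : Set (RelFree H X)) (f : ℕ → ℕ) : Prop :=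
  ∀ w : List (RelLetter H X), relEps H X (wordToF w) = 1 →
    ∃ k ≤ f w.length, ∃ r c : Fin k → RelFree H X,
      (∀ i, r i ∈ R) ∧ wordToF w = (List.ofFn fun i => (c i)⁻¹ * r i * c i).prod

/-- `⟨X, H | R⟩` is a finite relative presentation of `G` w.r.t. the collection `H`. -/
structure IsFiniteRelPres (H : Λ → Subgroup G) (X : Set G) (R : Set (RelFree H X)) : Prop where
  finX : X.Finite
  finR : R.Finite
  surj : Function.Surjective (relEps H X)
  ker : (relEps H X).ker = Subgroup.normalClosure R

/-- `G` is finitely presented relative to the collection of subgroups `H`. -/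
def FinitelyPresentedRel (H : Λ → Subgroup G) : Prop :=
  ∃ (X : Set G) (R : Set (RelFree H X)), IsFiniteRelPres H X R

/-- The relative area of a word representing `1`. -/
noncomputable def relArea (H : Λ → Subgroup G) (X : Set G) (R : Set (RelFree H X))
    (w : List (RelLetter H X)) : ℕ :=
  sInf {k | ∃ r c : Fin k → RelFree H X,
    (∀ i, r i ∈ R) ∧ wordToF w = (List.ofFn fun i => (c i)⁻¹ * r i * c i).prod}

/-- The relative Dehn function of the presentation `⟨X, H | R⟩`. -/
noncomputable def relDehn (H : Λ → Subgroup G) (X : Set G) (R : Set (RelFree H X))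
    (n : ℕ) : ℕ :=
  sSup {a | ∃ w : List (RelLetter H X), w.length ≤ n ∧ relEps H X (wordToF w) = 1 ∧
    a = relArea H X R w}

/-- The relative Dehn function is well-defined (finite for each value of the argument),
i.e. there exists a finite-valued relative isoperimetric function. -/
def DehnWellDefined (H : Λ → Subgroup G) (X : Set G) (R : Set (RelFree H X)) : Prop :=
  ∃ f : ℕ → ℕ, IsIsoperFn H X R f

/-- `f ⪯ g`. -/
def AsympLE (f g : ℕ → ℕ) : Prop := ∃ C K L : ℕ, ∀ n, f n ≤ C * g (K * n) + L * n

/-- `f ∼ g`. -/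
def AsympEquiv (f g : ℕ → ℕ) : Prop := AsympLE f g ∧ AsympLE g f

/-- `G` is hyperbolic relative to `H`: it admits a finite relative presentation with a
linear relative isoperimetric function. -/
def IsRelHyperbolic (H : Λ → Subgroup G) : Prop :=
  ∃ (X : Set G) (R : Set (RelFree H X)), IsFiniteRelPres H X R ∧
    ∃ A B : ℕ, IsIsoperFn H X R fun n => A * n + B

/-- The subnegative closure of `f`. -/
noncomputable def subnegClosure (f : ℕ → ℕ) (n : ℕ) : ℕ :=
  sSup {s | ∃ L : List ℕ, (∀ a ∈ L, 0 < a) ∧ L.sum = n ∧ s = (L.map f).sum}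

/-- A combinatorial path in the Cayley graph `Γ(G, X ∪ 𝓗)`: a starting vertex
together with the word labelling the path. -/
structure RelPath (H : Λ → Subgroup G) (X : Set G) where
  start : G
  word : List (RelLetter H X)

namespace RelPath

variable {H : Λ → Subgroup G} {X : Set G}

/-- The length of the path. -/
def len (p : RelPath H X) : ℕ := p.word.length

/-- The `k`-th vertex of the path. -/
def vertex (p : RelPath H X) (k : ℕ) : G :=
  p.start * ((p.word.take k).map RelLetter.val).prod

/-- The terminal vertex of the path. -/
def finish (p : RelPath H X) : G := p.vertex p.word.length

end RelPath

/-- The combinatorial metric `dist_{X ∪ 𝓗}` on `G`. -/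
noncomputable def relDist (H : Λ → Subgroup G) (X : Set G) (g h : G) : ℕ :=
  wordLength (X ∪ ⋃ l, (H l : Set G)) (g⁻¹ * h)

/-- The relative length `|g|_{X ∪ 𝓗}`. -/
noncomputable def relLen (H : Λ → Subgroup G) (X : Set G) (g : G) : ℕ :=
  wordLength (X ∪ ⋃ l, (H l : Set G)) g

/-- The word metric `dist_X` on `G`. -/
noncomputable def xDist (X : Set G) (g h : G) : ℕ := wordLength X (g⁻¹ * h)

variable {H : Λ → Subgroup G} {X : Set G}

/-- `p` is a `(λ, c)`-quasi-geodesic in `Γ(G, X ∪ 𝓗)`. -/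
def IsQuasiGeodesic (lam c : ℝ) (p : RelPath H X) : Prop :=
  ∀ i j : ℕ, i ≤ j → j ≤ p.len →
    ((j - i : ℕ) : ℝ) ≤ lam * (relDist H X (p.vertex i) (p.vertex j) : ℝ) + c

/-- `p` is a geodesic in `Γ(G, X ∪ 𝓗)`. -/
def IsGeodesic (p : RelPath H X) : Prop :=
  ∀ i j : ℕ, i ≤ j → j ≤ p.len → j - i = relDist H X (p.vertex i) (p.vertex j)

/-- The `k`-th letter of `p` is a letter of `H̃_l`. -/
def LetterIsH (p : RelPath H X) (l : Λ) (k : ℕ) : Prop :=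
  ∃ a, p.word[k]? = some a ∧ a.hIndex = some l

/-- The subpath of `p` consisting of the letters with indices `a, …, b` is an
`H_l`-component of `p` (a maximal nonempty `H_l`-subword). -/
def IsComponent (p : RelPath H X) (l : Λ) (a b : ℕ) : Prop :=
  a ≤ b ∧ b < p.len ∧ (∀ k, a ≤ k → k ≤ b → LetterIsH p l k) ∧
    (a = 0 ∨ ¬ LetterIsH p l (a - 1)) ∧ (b + 1 = p.len ∨ ¬ LetterIsH p l (b + 1))

/-- The `H_l`-components of `p` starting at index `a` and of `q` starting at `a'`
are connected (their vertices lie in the same left coset of `H_l`). -/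
def ConnectedComp (p q : RelPath H X) (l : Λ) (a a' : ℕ) : Prop :=
  (p.vertex a)⁻¹ * q.vertex a' ∈ H l

/-- `p` is a path without backtracking: all of its components are isolated. -/
def NoBacktracking (p : RelPath H X) : Prop :=
  ∀ l a b a' b', IsComponent p l a b → IsComponent p l a' b' →
    ConnectedComp p p l a a' → a = a' ∧ b = b'

/-- The `k`-th vertex of `p` is a phase vertex (not an inner vertex of a component). -/
def IsPhase (p : RelPath H X) (k : ℕ) : Prop :=
  ¬ ∃ l a b, IsComponent p l a b ∧ a < k ∧ k ≤ b

/-- `p` and `q` are `k`-similar: their endpoints are `X`-distance at most `k` apart. -/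
def Similar (k : ℝ) (p q : RelPath H X) : Prop :=
  (xDist X p.start q.start : ℝ) ≤ k ∧ (xDist X p.finish q.finish : ℝ) ≤ k

/-- The Rips thin-triangles condition for `Γ(G, X ∪ 𝓗)` with constant `δ`. -/
def RipsThin (H : Λ → Subgroup G) (X : Set G) (δ : ℝ) : Prop :=
  ∀ p q r : RelPath H X, IsGeodesic p → IsGeodesic q → IsGeodesic r →
    p.finish = q.start → q.finish = r.start → r.finish = p.start →
    ∀ i ≤ p.len, ∃ j : ℕ,
      (j ≤ q.len ∧ (relDist H X (p.vertex i) (q.vertex j) : ℝ) ≤ δ) ∨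
      (j ≤ r.len ∧ (relDist H X (p.vertex i) (r.vertex j) : ℝ) ≤ δ)

/-- The Cayley graph `Γ(G, X ∪ 𝓗)` is a hyperbolic metric space. -/
def CayleyHyperbolic (H : Λ → Subgroup G) (X : Set G) : Prop :=
  ∃ δ : ℝ, 0 ≤ δ ∧ RipsThin H X δ

/-- `R` is a relatively quasi-convex subgroup of `G`. -/
def RelQuasiconvex (H : Λ → Subgroup G) (X : Set G) (R : Subgroup G) : Prop :=
  ∃ σ : ℝ, 0 < σ ∧ ∀ p : RelPath H X, IsGeodesic p → p.start ∈ R → p.finish ∈ R →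
    ∀ k ≤ p.len, ∃ w ∈ R, (xDist X (p.vertex k) w : ℝ) ≤ σ

/-- `R` is a strongly relatively quasi-convex subgroup of `G`. -/
def StronglyRelQuasiconvex (H : Λ → Subgroup G) (X : Set G) (R : Subgroup G) : Prop :=
  RelQuasiconvex H X R ∧ ∀ (g : G) (l : Λ), {x : G | x ∈ R ∧ g * x * g⁻¹ ∈ H l}.Finite

/-- `g` is a hyperbolic element: it is not conjugate to an element of any `H_λ`. -/
def IsHypElt (H : Λ → Subgroup G) (g : G) : Prop :=
  ∀ l : Λ, ∀ x ∈ H l, ¬ IsConj g x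

end RelHyp

open RelHyp

open Asymptotics Filter

namespace RelHyp

/-- The semidirect product of the functions `G → ℤ` with `G` acting by right translation.
A homomorphism from `F` to this group that lifts `F → G` is a `1`-cochain on the Cayley graph,
additive along paths. -/
@[ext]
structure CochainGroup (G : Type*) where
  /-- The endpoint of a path starting at `1`. -/
  base : G
  /-- The integral along the path, as a function of its starting point. -/
  integral : G → ℤ

namespace CochainGroup

variable {G : Type*} [Group G]

instance : Mul (CochainGroup G) :=
  ⟨fun a b => ⟨a.base * b.base, fun v => a.integral v + b.integral (v * a.base)⟩⟩

instance : One (CochainGroup G) := ⟨⟨1, fun _ => 0⟩⟩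

instance : Inv (CochainGroup G) :=
  ⟨fun a => ⟨a.base⁻¹, fun v => -a.integral (v * a.base⁻¹)⟩⟩

@[simp] lemma mul_base (a b : CochainGroup G) : (a * b).base = a.base * b.base := rfl

@[simp] lemma mul_integral (a b : CochainGroup G) (v : G) :
    (a * b).integral v = a.integral v + b.integral (v * a.base) := rfl

@[simp] lemma one_base : (1 : CochainGroup G).base = 1 := rfl

@[simp] lemma one_integral (v : G) : (1 : CochainGroup G).integral v = 0 := rfl

@[simp] lemma inv_base (a : CochainGroup G) : a⁻¹.base = a.base⁻¹ := rfl

@[simp] lemma inv_integral (a : CochainGroup G) (v : G) :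
    a⁻¹.integral v = -a.integral (v * a.base⁻¹) := rfl

instance : Group (CochainGroup G) :=
  Group.ofLeftAxioms
    (fun a b c => by ext v <;> simp [mul_assoc, add_assoc])
    (fun a => by ext v <;> simp)
    (fun a => by ext v <;> simp)

/-- The projection to `G`. -/
def baseHom : CochainGroup G →* G where
  toFun := base
  map_one' := rfl
  map_mul' _ _ := rfl

lemma conj_integral {a : CochainGroup G} (ha : a.base = 1) (c : CochainGroup G) (v : G) :
    (c⁻¹ * a * c).integral v = a.integral (v * c.base⁻¹) := by
  simp [ha]

lemma abs_integral_prod_le {B : ℤ} (L : List (CochainGroup G))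
    (hL : ∀ a ∈ L, a.base = 1 ∧ ∀ v, |a.integral v| ≤ B) (v : G) :
    |L.prod.integral v| ≤ L.length * B := by
  induction L with
  | nil => simp
  | cons a L ih =>
    have h₁ := hL a (by simp)
    have h₂ := ih fun b hb => hL b (by simp [hb])
    have h₃ := abs_add_le (a.integral v) (L.prod.integral v)
    have h₄ := h₁.2 v
    simp only [List.prod_cons, mul_integral, h₁.1, mul_one, List.length_cons]
    push_cast
    linarith

end CochainGroup

section Words

variable {G : Type*} [Group G] {Λ : Type*} {H : Λ → Subgroup G} {X : Set G}

/-- The element of `G` represented by a word. -/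
def wordVal (w : List (RelLetter H X)) : G := relEps H X (wordToF w)

@[simp] lemma wordToF_nil : wordToF ([] : List (RelLetter H X)) = 1 := rfl

@[simp] lemma wordToF_cons (a : RelLetter H X) (w : List (RelLetter H X)) :
    wordToF (a :: w) = a.toF * wordToF w := by
  simp [wordToF]

@[simp] lemma wordToF_append (w w' : List (RelLetter H X)) :
    wordToF (w ++ w') = wordToF w * wordToF w' := by
  simp [wordToF]

@[simp] lemma wordVal_nil : wordVal ([] : List (RelLetter H X)) = 1 := by
  simp [wordVal]

@[simp] lemma wordVal_cons (a : RelLetter H X) (w : List (RelLetter H X)) :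
    wordVal (a :: w) = relEps H X a.toF * wordVal w := by
  simp [wordVal]

@[simp] lemma wordVal_append (w w' : List (RelLetter H X)) :
    wordVal (w ++ w') = wordVal w * wordVal w' := by
  simp [wordVal]

lemma relEps_of (l : Λ) (h : H l) :
    relEps H X (Monoid.Coprod.inl (Monoid.CoprodI.of h)) = h := by
  simp [relEps]

lemma relEps_freeOf (x : X) : relEps H X (Monoid.Coprod.inr (FreeGroup.of x)) = x := by
  simp [relEps]

lemma exists_wordToF_eq (u : RelFree H X) :
    ∃ w : List (RelLetter H X), wordToF w = u := by
  have hmul : ∀ u v : RelFree H X, (∃ w : List (RelLetter H X), wordToF w = u) →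
      (∃ w : List (RelLetter H X), wordToF w = v) →
      ∃ w : List (RelLetter H X), wordToF w = u * v := by
    rintro _ _ ⟨w, rfl⟩ ⟨w', rfl⟩
    exact ⟨w ++ w', by simp⟩
  induction u using Monoid.Coprod.induction_on with
  | inl m =>
    induction m using Monoid.CoprodI.induction_on with
    | one => exact ⟨[], by simp⟩
    | of l h =>
      by_cases hh : h = 1
      · exact ⟨[], by simp [hh]⟩
      · exact ⟨[Sum.inl ⟨l, h, hh⟩], by simp [RelLetter.toF]⟩
    | mul a b ha hb => rw [map_mul]; exact hmul _ _ ha hb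
  | inr m =>
    induction m using FreeGroup.induction_on with
    | C1 => exact ⟨[], by simp⟩
    | of x => exact ⟨[Sum.inr (x, true)], by simp [RelLetter.toF]⟩
    | inv_of x _ => exact ⟨[Sum.inr (x, false)], by simp [RelLetter.toF]⟩
    | mul a b ha hb => rw [map_mul]; exact hmul _ _ ha hb
  | mul a b ha hb => exact hmul _ _ ha hb

lemma exists_letter_toF_inv (a : RelLetter H X) : ∃ b : RelLetter H X, b.toF = a.toF⁻¹ := by
  rcases a with ⟨l, h, hh⟩ | ⟨x, _ | _⟩
  · exact ⟨Sum.inl ⟨l, h⁻¹, inv_ne_one.2 hh⟩, by simp [RelLetter.toF]⟩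
  · exact ⟨Sum.inr (x, true), by simp [RelLetter.toF]⟩
  · exact ⟨Sum.inr (x, false), by simp [RelLetter.toF]⟩

lemma exists_word_inv (w : List (RelLetter H X)) :
    ∃ w' : List (RelLetter H X), w'.length = w.length ∧ wordToF w' = (wordToF w)⁻¹ := by
  induction w with
  | nil => exact ⟨[], by simp⟩
  | cons a w ih =>
    obtain ⟨w', hl, hw⟩ := ih
    obtain ⟨b, hb⟩ := exists_letter_toF_inv a
    exact ⟨w' ++ [b], by simp [hl], by simp [hw, hb]⟩

/-- `v` lies on the path starting at `s` with label `w`. -/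
def OnPath (s : G) (w : List (RelLetter H X)) (v : G) : Prop :=
  ∃ p q, w = p ++ q ∧ v = s * wordVal p

lemma onPath_start (s : G) (w : List (RelLetter H X)) : OnPath s w s :=
  ⟨[], w, by simp⟩

lemma onPath_finish (s : G) (w : List (RelLetter H X)) : OnPath s w (s * wordVal w) :=
  ⟨w, [], by simp⟩

lemma OnPath.cons {s v : G} {a : RelLetter H X} {w : List (RelLetter H X)}
    (h : OnPath (s * relEps H X a.toF) w v) : OnPath s (a :: w) v := by
  obtain ⟨p, q, rfl, rfl⟩ := h
  exact ⟨a :: p, q, by simp [mul_assoc]⟩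

end Words

section Cochain

variable {G : Type*} [Group G] {Λ : Type*} {H : Λ → Subgroup G} {X : Set G}

/-- `f` changes by at most `1` along each edge of `Γ(G, X ∪ 𝓗)`. -/
structure EdgeLipschitz (H : Λ → Subgroup G) (X : Set G) (f : G → ℤ) : Prop where
  abs_sub_le_of_mem : ∀ (v : G) (l : Λ), ∀ h ∈ H l, |f (v * h) - f v| ≤ 1
  abs_sub_le_of_gen : ∀ (v : G), ∀ x ∈ X, |f (v * x) - f v| ≤ 1

lemma EdgeLipschitz.abs_sub_le_letter {f : G → ℤ} (hf : EdgeLipschitz H X f) (v : G)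
    (a : RelLetter H X) : |f (v * relEps H X a.toF) - f v| ≤ 1 := by
  rcases a with ⟨l, h, hh⟩ | ⟨x, _ | _⟩
  · simpa [RelLetter.toF, relEps_of] using hf.abs_sub_le_of_mem v l h h.2
  · have := hf.abs_sub_le_of_gen (v * (x : G)⁻¹) x x.2
    rw [abs_sub_comm]
    simpa [RelLetter.toF, relEps_freeOf] using this
  · simpa [RelLetter.toF, relEps_freeOf] using hf.abs_sub_le_of_gen v x x.2

/-- The representative of the coset of `v`. -/
noncomputable def cosetRep (N : Subgroup G) (v : G) : G := (v : G ⧸ N).out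

lemma cosetRep_mul_mem {N : Subgroup G} (v : G) {h : G} (hh : h ∈ N) :
    cosetRep N (v * h) = cosetRep N v := by
  rw [cosetRep, QuotientGroup.mk_mul_of_mem v hh, cosetRep]

lemma exists_cosetRep_eq_mul (N : Subgroup G) (v : G) : ∃ h ∈ N, cosetRep N v = v * h := by
  obtain ⟨h, hh⟩ := QuotientGroup.mk_out_eq_mul N v
  exact ⟨h, h.2, hh⟩

/-- A version of the `1`-form `f dg` on the Cayley graph `Γ(G, X ∪ 𝓗)` whose restriction to every
coset of every `H_λ` is exact. -/
noncomputable def cochainHom (H : Λ → Subgroup G) (X : Set G) (f g : G → ℤ) :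
    RelFree H X →* CochainGroup G :=
  Monoid.Coprod.lift
    (Monoid.CoprodI.lift fun l =>
      { toFun := fun h => ⟨h, fun v => f (cosetRep (H l) v) * (g (v * h) - g v)⟩
        map_one' := by ext v <;> simp
        map_mul' := fun h k => by
          ext v
          · simp
          · simp only [Subgroup.coe_mul, CochainGroup.mul_integral, cosetRep_mul_mem v h.2,
              mul_assoc]
            ring })
    (FreeGroup.lift fun x => ⟨x, fun v => f v * (g (v * x) - g v)⟩)

@[simp] lemma cochainHom_base (f g : G → ℤ) (u : RelFree H X) :
    (cochainHom H X f g u).base = relEps H X u := by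
  have : CochainGroup.baseHom.comp (cochainHom H X f g) = relEps H X := by
    apply Monoid.Coprod.hom_ext
    · ext l h
      simp [cochainHom, relEps, CochainGroup.baseHom]
    · ext x
      simp [cochainHom, relEps, CochainGroup.baseHom]
  exact DFunLike.congr_fun this u

lemma cochainHom_letter (f g : G → ℤ) (a : RelLetter H X) (v : G) :
    ∃ u, (u = v ∨ u = v * relEps H X a.toF ∨ ∃ l, ∃ h ∈ H l, u = v * h) ∧
      (cochainHom H X f g a.toF).integral v = f u * (g (v * relEps H X a.toF) - g v) := by
  rcases a with ⟨l, h, hh⟩ | ⟨x, _ | _⟩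
  · obtain ⟨k, hk, hrep⟩ := exists_cosetRep_eq_mul (H l) v
    refine ⟨cosetRep (H l) v, Or.inr (Or.inr ⟨l, k, hk, hrep⟩), ?_⟩
    simp [RelLetter.toF, relEps_of, cochainHom]
  · refine ⟨_, Or.inr (Or.inl rfl), ?_⟩
    simp [RelLetter.toF, relEps_freeOf, cochainHom]
    ring
  · refine ⟨v, Or.inl rfl, ?_⟩
    simp [RelLetter.toF, relEps_freeOf, cochainHom]

lemma abs_cochainHom_sub_le {f g : G → ℤ} (hf : EdgeLipschitz H X f) (hg : EdgeLipschitz H X g)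
    (c : ℤ) (w : List (RelLetter H X)) (v : G) (s : ℤ) (hs : |f v - c| ≤ s) :
    |(cochainHom H X f g (wordToF w)).integral v - c * (g (v * wordVal w) - g v)| ≤
      w.length * (s + w.length) := by
  induction w generalizing v s with
  | nil => simp
  | cons a w ih =>
    obtain ⟨u, hu, hint⟩ := cochainHom_letter f g a v
    set v' := v * relEps H X a.toF with hv'
    have hfv : |f v' - f v| ≤ 1 := hf.abs_sub_le_letter v a
    have hgv : |g v' - g v| ≤ 1 := hg.abs_sub_le_letter v a
    have h₁ := ih v' (s + 1) (by
      have := abs_sub_le (f v') (f v) c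
      linarith)
    have h₂ : |f u - f v| ≤ 1 := by
      rcases hu with rfl | rfl | ⟨l, h, hh, rfl⟩
      · simp
      · exact hfv
      · exact hf.abs_sub_le_of_mem v l h hh
    have h₃ : |f u - c| ≤ s + 1 := by
      have := abs_sub_le (f u) (f v) c
      linarith
    have h₄ : |(f u - c) * (g v' - g v)| ≤ s + 1 := by
      rw [abs_mul]
      calc |f u - c| * |g v' - g v| ≤ (s + 1) * 1 := by
            gcongr
            exact (abs_nonneg _).trans h₃
        _ = s + 1 := mul_one _
    have hsplit : (cochainHom H X f g (wordToF (a :: w))).integral v -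
        c * (g (v * wordVal (a :: w)) - g v) =
        (f u - c) * (g v' - g v) + ((cochainHom H X f g (wordToF w)).integral v' -
          c * (g (v' * wordVal w) - g v')) := by
      simp only [wordToF_cons, map_mul, CochainGroup.mul_integral, cochainHom_base, hint,
        wordVal_cons, ← mul_assoc, ← hv']
      ring
    rw [hsplit, List.length_cons]
    push_cast
    have := abs_add_le ((f u - c) * (g v' - g v)) ((cochainHom H X f g (wordToF w)).integral v' -
          c * (g (v' * wordVal w) - g v'))
    nlinarith

lemma cochainHom_eq_of_const {f : G → ℤ} (g : G → ℤ) {c : ℤ} (w : List (RelLetter H X)) (v : G)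
    (hf : ∀ u, OnPath v w u → f u = c ∧ ∀ l, ∀ h ∈ H l, f (u * h) = c) :
    (cochainHom H X f g (wordToF w)).integral v = c * (g (v * wordVal w) - g v) := by
  induction w generalizing v with
  | nil => simp
  | cons a w ih =>
    obtain ⟨u, hu, hint⟩ := cochainHom_letter f g a v
    have h₁ := ih _ fun u hu => hf u hu.cons
    have h₂ : f u = c := by
      rcases hu with rfl | rfl | ⟨l, h, hh, rfl⟩
      · exact (hf u (onPath_start _ _)).1
      · exact (hf _ (onPath_start _ w).cons).1
      · exact (hf v (onPath_start _ _)).2 l h hh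
    simp only [wordToF_cons, map_mul, CochainGroup.mul_integral, cochainHom_base, hint,
      wordVal_cons, ← mul_assoc, h₁, h₂]
    ring

lemma cochainHom_eq_zero_of_const (f : G → ℤ) {g : G → ℤ} {c : ℤ} (w : List (RelLetter H X))
    (v : G) (hg : ∀ u, OnPath v w u → g u = c) :
    (cochainHom H X f g (wordToF w)).integral v = 0 := by
  induction w generalizing v with
  | nil => simp
  | cons a w ih =>
    obtain ⟨u, -, hint⟩ := cochainHom_letter f g a v
    have h₁ := ih _ fun u hu => hg u hu.cons
    simp only [wordToF_cons, map_mul, CochainGroup.mul_integral, cochainHom_base, hint, h₁,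
      hg v (onPath_start _ _), hg _ (onPath_start _ w).cons]
    ring

end Cochain

section Filling

variable {G : Type*} [Group G] {Λ : Type*} {H : Λ → Subgroup G} {X : Set G}
  {R : Set (RelFree H X)}

/-- `u` is a product of `k` conjugates of elements of `R`. -/
def HasFilling (R : Set (RelFree H X)) (u : RelFree H X) (k : ℕ) : Prop :=
  ∃ r c : Fin k → RelFree H X,
    (∀ i, r i ∈ R) ∧ u = (List.ofFn fun i => (c i)⁻¹ * r i * c i).prod

lemma hasFilling_iff_list {u : RelFree H X} {k : ℕ} :
    HasFilling R u k ↔ ∃ L : List (RelFree H X), L.length = k ∧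
      (∀ x ∈ L, ∃ r ∈ R, ∃ c, x = c⁻¹ * r * c) ∧ u = L.prod := by
  constructor
  · rintro ⟨r, c, hr, hu⟩
    refine ⟨_, List.length_ofFn, ?_, hu⟩
    intro x hx
    obtain ⟨i, rfl⟩ := (List.mem_ofFn' _ _).1 hx
    exact ⟨r i, hr i, c i, rfl⟩
  · rintro ⟨L, rfl, hL, hu⟩
    choose r hr c hc using fun i : Fin L.length => hL (L.get i) (L.get_mem i)
    refine ⟨r, c, hr, ?_⟩
    rw [hu]
    congr 1
    simp only [← hc]
    exact (List.ofFn_get L).symm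

lemma HasFilling.mul {u v : RelFree H X} {k m : ℕ} (hu : HasFilling R u k)
    (hv : HasFilling R v m) : HasFilling R (u * v) (k + m) := by
  rw [hasFilling_iff_list] at *
  obtain ⟨L, rfl, hL, rfl⟩ := hu
  obtain ⟨M, rfl, hM, rfl⟩ := hv
  refine ⟨L ++ M, by simp, ?_, by simp⟩
  intro x hx
  rcases List.mem_append.1 hx with h | h
  exacts [hL x h, hM x h]

lemma HasFilling.conj {u : RelFree H X} {k : ℕ} (hu : HasFilling R u k) (d : RelFree H X) :
    HasFilling R (d * u * d⁻¹) k := by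
  obtain ⟨r, c, hr, rfl⟩ := hu
  refine ⟨r, fun i => c i * d⁻¹, hr, ?_⟩
  rw [← MulAut.conj_apply, map_list_prod, List.map_ofFn]
  congr 2
  funext i
  simp [mul_assoc]

lemma exists_forall_abs_cochainHom_le (hpres : IsFiniteRelPres H X R) :
    ∃ B : ℕ, ∀ f g : G → ℤ, EdgeLipschitz H X f → EdgeLipschitz H X g → ∀ r ∈ R, ∀ v,
      |(cochainHom H X f g r).integral v| ≤ B := by
  choose word hword using exists_wordToF_eq (H := H) (X := X)
  obtain ⟨B, hB⟩ := (hpres.finR.image fun r => (word r).length ^ 2).bddAbove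
  refine ⟨B, fun f g hf hg r hr v => ?_⟩
  have hr1 : wordVal (word r) = 1 := by
    rw [wordVal, hword, ← MonoidHom.mem_ker, hpres.ker]
    exact Subgroup.subset_normalClosure hr
  have h₁ := abs_cochainHom_sub_le hf hg (f v) (word r) v 0 (by simp)
  rw [hr1, hword] at h₁
  have h₂ : (word r).length ^ 2 ≤ B := hB ⟨r, hr, rfl⟩
  have h₃ : ((word r).length : ℤ) ^ 2 ≤ B := by exact_mod_cast h₂
  simp only [mul_one, sub_self, mul_zero, sub_zero, zero_add] at h₁
  nlinarith

lemma HasFilling.abs_integral_le (hpres : IsFiniteRelPres H X R) {B : ℤ} {f g : G → ℤ}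
    (hB : ∀ r ∈ R, ∀ v, |(cochainHom H X f g r).integral v| ≤ B) {u : RelFree H X} {k : ℕ}
    (hu : HasFilling R u k) (v : G) : |(cochainHom H X f g u).integral v| ≤ k * B := by
  obtain ⟨L, rfl, hL, rfl⟩ := hasFilling_iff_list.1 hu
  rw [map_list_prod]
  refine (CochainGroup.abs_integral_prod_le (B := B) _ ?_ v).trans_eq (by simp)
  intro a ha
  obtain ⟨x, hx, rfl⟩ := List.mem_map.1 ha
  obtain ⟨r, hr, c, rfl⟩ := hL x hx
  have hr1 : (cochainHom H X f g r).base = 1 := by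
    rw [cochainHom_base, ← MonoidHom.mem_ker, hpres.ker]
    exact Subgroup.subset_normalClosure hr
  refine ⟨by rw [cochainHom_base] at hr1; simp [hr1], fun v => ?_⟩
  rw [map_mul, map_mul, map_inv, CochainGroup.conj_integral hr1]
  exact hB r hr _

end Filling

end RelHyp

namespace RelHyp

section Recursion

/-- `F n` is bounded by the sum of two values of `F` at arguments that are the lengths of the pieces
of a loop of length `n` cut by a shortcut of length `d`, of order at most the square root of `F n`,
into two arcs of length at most about `3 n / 4`. -/
def QuarterCut (B : ℕ) (F : ℕ → ℕ) : Prop :=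
  ∀ n, ∃ y z d : ℕ, F n ≤ F y + F z ∧ y + z ≤ n + 2 * d ∧ y ≤ n - n / 4 + d ∧
    z ≤ n - n / 4 + d ∧ d ≤ Nat.sqrt (B * F n) + 3

lemma cast_le_sqrt_add_three {B d m : ℕ} {K : ℝ} (hd : d ≤ Nat.sqrt (B * m) + 3)
    (hK : 0 ≤ K) (hm : (B * m : ℝ) ≤ K ^ 2) : (d : ℝ) ≤ K + 3 := by
  have h₁ : ((Nat.sqrt (B * m) : ℕ) : ℝ) ≤ √((B * m : ℕ) : ℝ) := Real.nat_sqrt_le_real_sqrt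
  have h₂ : √((B * m : ℕ) : ℝ) ≤ K := by
    rw [Real.sqrt_le_left hK]
    exact_mod_cast hm
  have h₃ : (d : ℝ) ≤ (Nat.sqrt (B * m) : ℕ) + 3 := by exact_mod_cast hd
  linarith

lemma cast_le_of_quarterCut {n d y : ℕ} (hn : 1000 ≤ n) (hd : (d : ℝ) ≤ 33 / 1000 * n)
    (hy : y ≤ n - n / 4 + d) : (y : ℝ) ≤ 4 / 5 * n := by
  have h₁ : 4 * y ≤ 3 * n + 3 + 4 * d := by omega
  have h₂ : (4 * y : ℝ) ≤ 3 * n + 3 + 4 * d := by exact_mod_cast h₁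
  have h₃ : (1000 : ℝ) ≤ n := by exact_mod_cast hn
  linarith

/-- A subquadratic function satisfying the cutting recursion is eventually cut by shortcuts of
small linear length. -/
lemma QuarterCut.eventually_cut {B : ℕ} {F : ℕ → ℕ} (hcut : QuarterCut B F)
    (hsub : (fun n : ℕ => (F n : ℝ)) =o[atTop] (fun n : ℕ => (n : ℝ) ^ 2)) :
    ∃ N : ℕ, 1 ≤ N ∧ ∀ n ≥ N, ∃ y z d : ℕ, F n ≤ F y + F z ∧ y + z ≤ n + 2 * d ∧
      (y : ℝ) ≤ 4 / 5 * n ∧ (z : ℝ) ≤ 4 / 5 * n ∧ (d : ℝ) ≤ 33 / 1000 * n ∧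
      d ≤ Nat.sqrt (B * F n) + 3 := by
  have hε : (0 : ℝ) < 9 / 10000 / (B + 1) := by positivity
  obtain ⟨N, hN⟩ := eventually_atTop.1 (hsub.bound hε)
  refine ⟨max N 1000, by omega, fun n hn => ?_⟩
  have hn₁ : N ≤ n := le_trans (le_max_left _ _) hn
  have hn₂ : 1000 ≤ n := le_trans (le_max_right _ _) hn
  have hn₃ : (1000 : ℝ) ≤ n := by exact_mod_cast hn₂
  obtain ⟨y, z, d, hF, hyz, hy, hz, hd⟩ := hcut n
  have hFn : (F n : ℝ) ≤ 9 / 10000 / (B + 1) * n ^ 2 := by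
    simpa using hN n hn₁
  have hd' : (d : ℝ) ≤ 33 / 1000 * n := by
    have := cast_le_sqrt_add_three (K := 3 / 100 * n) hd (by positivity) (by
      calc (B * F n : ℝ) ≤ (B + 1) * (9 / 10000 / (B + 1) * n ^ 2) := by
            gcongr
            linarith
        _ = (3 / 100 * n) ^ 2 := by field_simp; norm_num)
    linarith
  exact ⟨y, z, d, hF, hyz, cast_le_of_quarterCut hn₂ hd' hy, cast_le_of_quarterCut hn₂ hd' hz,
    hd', hd⟩

lemma QuarterCut.exists_le_mul_sqrt {B : ℕ} {F : ℕ → ℕ} (hcut : QuarterCut B F)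
    (hmono : Monotone F) (h0 : F 0 = 0)
    (hsub : (fun n : ℕ => (F n : ℝ)) =o[atTop] (fun n : ℕ => (n : ℝ) ^ 2)) :
    ∃ A : ℝ, 0 ≤ A ∧ ∀ n, (F n : ℝ) ≤ A * (n * √n) := by
  obtain ⟨N, hN1, hN⟩ := hcut.eventually_cut hsub
  refine ⟨F N, by positivity, fun n => ?_⟩
  induction n using Nat.strong_induction_on with
  | _ n ih =>
  rcases Nat.eq_zero_or_pos n with rfl | hn0
  · simp [h0]
  have hn1 : (1 : ℝ) ≤ n := by exact_mod_cast hn0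
  rcases lt_or_ge n N with hn | hn
  · have h₁ : (F n : ℝ) ≤ F N := by exact_mod_cast hmono hn.le
    have h₂ : 1 ≤ √(n : ℝ) := Real.one_le_sqrt.2 hn1
    have h₃ : 1 ≤ n * √(n : ℝ) := one_le_mul_of_one_le_of_one_le hn1 h₂
    exact h₁.trans (le_mul_of_one_le_right (by positivity) h₃)
  · obtain ⟨y, z, d, hF, hyz, hy, hz, hd, -⟩ := hN n hn
    have key : ∀ x : ℕ, (x : ℝ) ≤ 4 / 5 * n → (F x : ℝ) ≤ F N * (x * (9 / 10 * √n)) := by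
      intro x hx
      have hxn : x < n := by
        have : (x : ℝ) < n := by linarith
        exact_mod_cast this
      refine (ih x hxn).trans ?_
      have : √(x : ℝ) ≤ 9 / 10 * √n := by
        rw [Real.sqrt_le_left (by positivity), mul_pow, Real.sq_sqrt (by positivity)]
        linarith
      gcongr
    have h₁ : (F n : ℝ) ≤ F y + F z := by exact_mod_cast hF
    have h₂ : (y + z : ℝ) ≤ n + 2 * d := by exact_mod_cast hyz
    calc (F n : ℝ) ≤ F N * (y * (9 / 10 * √n)) + F N * (z * (9 / 10 * √n)) :=
          h₁.trans (add_le_add (key y hy) (key z hz))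
      _ = F N * ((9 / 10 * (y + z)) * √n) := by ring
      _ ≤ F N * (n * √n) := by
          gcongr
          linarith

lemma QuarterCut.exists_le_mul {B : ℕ} {F : ℕ → ℕ} (hcut : QuarterCut B F)
    (hmono : Monotone F) (h0 : F 0 = 0)
    (hsub : (fun n : ℕ => (F n : ℝ)) =o[atTop] (fun n : ℕ => (n : ℝ) ^ 2)) :
    ∃ C : ℝ, ∀ n, (F n : ℝ) ≤ C * n := by
  obtain ⟨N, hN1, hN⟩ := hcut.eventually_cut hsub
  obtain ⟨A, hA, hFA⟩ := hcut.exists_le_mul_sqrt hmono h0 hsub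
  set D : ℝ := √(B * A) + 3 with hD
  have hD0 : 0 ≤ D := by positivity
  set M : ℝ := F N * Real.exp (40 * D) with hM
  have hM0 : 0 ≤ M := by positivity
  have main : ∀ n : ℕ, (F n : ℝ) ≤ M * (n * Real.exp (-(40 * D / √√(n : ℝ)))) := by
    intro n
    induction n using Nat.strong_induction_on with
    | _ n ih =>
    rcases Nat.eq_zero_or_pos n with rfl | hn0
    · simp [h0]
    have hn1 : (1 : ℝ) ≤ n := by exact_mod_cast hn0
    set r : ℝ := √√(n : ℝ) with hr
    have hr1 : 1 ≤ r := Real.one_le_sqrt.2 (Real.one_le_sqrt.2 hn1)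
    have hr2 : r ^ 2 = √(n : ℝ) := Real.sq_sqrt (by positivity)
    have hr4 : (n : ℝ) = r ^ 4 := by
      calc (n : ℝ) = √(n : ℝ) ^ 2 := (Real.sq_sqrt (by positivity)).symm
        _ = r ^ 4 := by rw [← hr2]; ring
    rcases lt_or_ge n N with hn | hn
    · have h₁ : (F n : ℝ) ≤ F N := by exact_mod_cast hmono hn.le
      have h₂ : 40 * D / r ≤ 40 * D := div_le_self (by positivity) hr1
      calc (F n : ℝ) ≤ F N * (Real.exp (40 * D) * Real.exp (-(40 * D))) := by
            rwa [← Real.exp_add, add_neg_cancel, Real.exp_zero, mul_one]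
        _ = M * (1 * Real.exp (-(40 * D))) := by rw [hM]; ring
        _ ≤ M * (n * Real.exp (-(40 * D / r))) := by gcongr
    · obtain ⟨y, z, d, hF, hyz, hy, hz, -, hd⟩ := hN n hn
      have key : ∀ x : ℕ, (x : ℝ) ≤ 4 / 5 * n →
          (F x : ℝ) ≤ M * (x * Real.exp (-(42 * D / r))) := by
        intro x hx
        have hxn : x < n := by
          have : (x : ℝ) < n := by linarith
          exact_mod_cast this
        refine (ih x hxn).trans ?_
        rcases Nat.eq_zero_or_pos x with rfl | hx0
        · simp
        have hpos : 0 < √√(x : ℝ) := by positivity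
        have hle : √√(x : ℝ) ≤ 19 / 20 * r := by
          rw [Real.sqrt_le_left (by positivity), Real.sqrt_le_left (by positivity)]
          calc (x : ℝ) ≤ 4 / 5 * r ^ 4 := by rw [← hr4]; exact hx
            _ ≤ ((19 / 20 * r) ^ 2) ^ 2 := by nlinarith [pow_nonneg (zero_le_one.trans hr1) 4]
        have : 42 * D / r ≤ 40 * D / √√(x : ℝ) := by
          rw [div_le_div_iff₀ (by positivity) hpos]
          calc 42 * D * √√(x : ℝ) ≤ 42 * D * (19 / 20 * r) := by gcongr
            _ ≤ 40 * D * r := by nlinarith [mul_nonneg hD0 (zero_le_one.trans hr1)]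
        gcongr
      have h₁ : (F n : ℝ) ≤ F y + F z := by exact_mod_cast hF
      have h₂ : (y + z : ℝ) ≤ n + 2 * d := by exact_mod_cast hyz
      have h₃ : (d : ℝ) ≤ D * r ^ 3 := by
        have := cast_le_sqrt_add_three (K := √(B * A) * r ^ 3) hd (by positivity) (by
          calc (B * F n : ℝ) ≤ B * (A * (n * √n)) := by
                gcongr
                exact hFA n
            _ = B * A * r ^ 6 := by rw [← hr2, hr4]; ring
            _ = (√(B * A) * r ^ 3) ^ 2 := by
                rw [mul_pow, Real.sq_sqrt (by positivity)]; ring)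
        have hr3 : 1 ≤ r ^ 3 := one_le_pow₀ hr1
        rw [hD]
        linarith
      have h₄ : (y + z : ℝ) ≤ n * Real.exp (2 * D / r) := by
        calc (y + z : ℝ) ≤ n + 2 * (D * r ^ 3) := by linarith
          _ = n * (2 * D / r + 1) := by rw [hr4]; field_simp; ring
          _ ≤ n * Real.exp (2 * D / r) := by
              gcongr
              exact Real.add_one_le_exp _
      calc (F n : ℝ) ≤ M * (y * Real.exp (-(42 * D / r))) + M * (z * Real.exp (-(42 * D / r))) :=
            h₁.trans (add_le_add (key y hy) (key z hz))
        _ = M * ((y + z) * Real.exp (-(42 * D / r))) := by ring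
        _ ≤ M * (n * Real.exp (2 * D / r) * Real.exp (-(42 * D / r))) := by gcongr
        _ = M * (n * Real.exp (-(40 * D / r))) := by
            rw [mul_assoc (n : ℝ), ← Real.exp_add]
            congr 3
            ring
  refine ⟨M, fun n => (main n).trans ?_⟩
  have : Real.exp (-(40 * D / √√(n : ℝ))) ≤ 1 := by
    rw [Real.exp_le_one_iff]
    have : 0 ≤ 40 * D / √√(n : ℝ) := by positivity
    linarith
  gcongr
  exact mul_le_of_le_one_right (by positivity) this

end Recursion

end RelHyp

namespace RelHyp

section Cutting

variable {G : Type*} [Group G] {Λ : Type*} {H : Λ → Subgroup G} {X : Set G}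
  {R : Set (RelFree H X)}

/-- The distance in `Γ(G, X ∪ 𝓗)` from the set `S` to `v`. -/
noncomputable def setDist (H : Λ → Subgroup G) (X : Set G) (S : Set G) (v : G) : ℕ :=
  sInf {n | ∃ s ∈ S, ∃ w : List (RelLetter H X), w.length = n ∧ s * wordVal w = v}

lemma setDist_le {S : Set G} {s : G} (hs : s ∈ S) (w : List (RelLetter H X)) :
    setDist H X S (s * wordVal w) ≤ w.length :=
  Nat.sInf_le ⟨s, hs, w, rfl, rfl⟩

lemma setDist_eq_zero {S : Set G} {s : G} (hs : s ∈ S) : setDist H X S s = 0 := by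
  have := setDist_le (H := H) (X := X) hs []
  simpa using this

lemma exists_word_setDist (hsurj : Function.Surjective (relEps H X)) {S : Set G}
    (hS : S.Nonempty) (v : G) :
    ∃ s ∈ S, ∃ w : List (RelLetter H X), w.length = setDist H X S v ∧ s * wordVal w = v := by
  refine Nat.sInf_mem (s := {n | ∃ s ∈ S, ∃ w : List (RelLetter H X),
    w.length = n ∧ s * wordVal w = v}) ?_
  obtain ⟨s, hs⟩ := hS
  obtain ⟨u, hu⟩ := hsurj (s⁻¹ * v)
  obtain ⟨w, rfl⟩ := exists_wordToF_eq u
  exact ⟨_, s, hs, w, rfl, by simp [wordVal, hu]⟩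

lemma setDist_mul_letter_le (hsurj : Function.Surjective (relEps H X)) {S : Set G}
    (hS : S.Nonempty) (v : G) (a : RelLetter H X) :
    setDist H X S (v * relEps H X a.toF) ≤ setDist H X S v + 1 := by
  obtain ⟨s, hs, w, hl, hw⟩ := exists_word_setDist hsurj hS v
  have := setDist_le hs (w ++ [a])
  simpa [← mul_assoc, hw, hl] using this

lemma setDist_mul_mem_le (hsurj : Function.Surjective (relEps H X)) {S : Set G}
    (hS : S.Nonempty) (v : G) {l : Λ} {h : G} (hh : h ∈ H l) :
    setDist H X S (v * h) ≤ setDist H X S v + 1 := by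
  by_cases h1 : h = 1
  · simp [h1]
  · have := setDist_mul_letter_le hsurj hS v
      (Sum.inl ⟨l, ⟨h, hh⟩, by simpa [Subtype.ext_iff] using h1⟩)
    simpa [RelLetter.toF, relEps_of] using this

lemma setDist_le_mul_mem (hsurj : Function.Surjective (relEps H X)) {S : Set G}
    (hS : S.Nonempty) (v : G) {l : Λ} {h : G} (hh : h ∈ H l) :
    setDist H X S v ≤ setDist H X S (v * h) + 1 := by
  simpa using setDist_mul_mem_le hsurj hS (v * h) (inv_mem hh)

lemma setDist_mul_gen_le (hsurj : Function.Surjective (relEps H X)) {S : Set G}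
    (hS : S.Nonempty) (v : G) {x : G} (hx : x ∈ X) :
    setDist H X S (v * x) ≤ setDist H X S v + 1 := by
  simpa [RelLetter.toF, relEps_freeOf] using
    setDist_mul_letter_le hsurj hS v (Sum.inr (⟨x, hx⟩, true))

lemma setDist_le_mul_gen (hsurj : Function.Surjective (relEps H X)) {S : Set G}
    (hS : S.Nonempty) (v : G) {x : G} (hx : x ∈ X) :
    setDist H X S v ≤ setDist H X S (v * x) + 1 := by
  simpa [RelLetter.toF, relEps_freeOf] using
    setDist_mul_letter_le hsurj hS (v * x) (Sum.inr (⟨x, hx⟩, false))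

lemma edgeLipschitz_comp_setDist (hsurj : Function.Surjective (relEps H X)) {S : Set G}
    (hS : S.Nonempty) {φ : ℕ → ℤ} (hφ : ∀ m n : ℕ, m ≤ n + 1 → n ≤ m + 1 → |φ m - φ n| ≤ 1) :
    EdgeLipschitz H X fun v => φ (setDist H X S v) where
  abs_sub_le_of_mem v _ _ hh :=
    hφ _ _ (setDist_mul_mem_le hsurj hS v hh) (setDist_le_mul_mem hsurj hS v hh)
  abs_sub_le_of_gen v _ hx :=
    hφ _ _ (setDist_mul_gen_le hsurj hS v hx) (setDist_le_mul_gen hsurj hS v hx)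

/-- The rectangle inequality: in a quadrilateral of small relative area one of the two pairs of
opposite sides is joined by a short path. -/
lemma exists_short_connection (hpres : IsFiniteRelPres H X R) :
    ∃ B : ℕ, ∀ (A₁ A₂ A₃ A₄ : List (RelLetter H X)) (k d : ℕ),
      wordVal (A₁ ++ A₂ ++ A₃ ++ A₄) = 1 →
      HasFilling R (wordToF (A₁ ++ A₂ ++ A₃ ++ A₄)) k → 2 ≤ d → B * k < (d - 2) * d →
      (∃ u u', OnPath 1 A₁ u ∧ OnPath (wordVal (A₁ ++ A₂)) A₃ u' ∧
        ∃ t : List (RelLetter H X), t.length < d ∧ u * wordVal t = u') ∨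
      (∃ u u', OnPath (wordVal A₁) A₂ u ∧ OnPath (wordVal (A₁ ++ A₂ ++ A₃)) A₄ u' ∧
        ∃ t : List (RelLetter H X), t.length < d ∧ u * wordVal t = u') := by
  obtain ⟨B, hB⟩ := exists_forall_abs_cochainHom_le hpres
  refine ⟨B, fun A₁ A₂ A₃ A₄ k d hloop hfill hd hlt => ?_⟩
  by_contra hcon
  obtain ⟨hno₁, hno₂⟩ := not_or.1 hcon
  have hsurj := hpres.surj
  set S₁ : Set G := {u | OnPath 1 A₁ u}
  set S₂ : Set G := {u | OnPath (wordVal A₁) A₂ u}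
  have hS₁ : S₁.Nonempty := ⟨_, onPath_start _ _⟩
  have hS₂ : S₂.Nonempty := ⟨_, onPath_start _ _⟩
  have hfar₁ : ∀ u, OnPath (wordVal (A₁ ++ A₂)) A₃ u → d ≤ setDist H X S₁ u := by
    intro u hu
    by_contra hlt
    obtain ⟨s, hs, t, htl, ht⟩ := exists_word_setDist hsurj hS₁ u
    exact hno₁ ⟨s, u, hs, hu, t, by omega, ht⟩
  have hfar₂ : ∀ u, OnPath (wordVal (A₁ ++ A₂ ++ A₃)) A₄ u → d ≤ setDist H X S₂ u := by
    intro u hu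
    by_contra hlt
    obtain ⟨s, hs, t, htl, ht⟩ := exists_word_setDist hsurj hS₂ u
    exact hno₂ ⟨s, u, hs, hu, t, by omega, ht⟩
  set f : G → ℤ := fun v => ((min (setDist H X S₁ v - 1) (d - 2) : ℕ) : ℤ) with hf
  set g : G → ℤ := fun v => ((min (setDist H X S₂ v) d : ℕ) : ℤ) with hg
  have hfL : EdgeLipschitz H X f :=
    edgeLipschitz_comp_setDist hsurj hS₁ (φ := fun n => ((min (n - 1) (d - 2) : ℕ) : ℤ))
      fun m n _ _ => abs_le.2 (by constructor <;> omega)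
  have hgL : EdgeLipschitz H X g :=
    edgeLipschitz_comp_setDist hsurj hS₂ (φ := fun n => ((min n d : ℕ) : ℤ))
      fun m n _ _ => abs_le.2 (by constructor <;> omega)
  have hI₁ : (cochainHom H X f g (wordToF A₁)).integral 1 = 0 := by
    rw [cochainHom_eq_of_const (c := 0), zero_mul]
    intro u hu
    have h0 : setDist H X S₁ u = 0 := setDist_eq_zero hu
    refine ⟨by simp [hf, h0], fun l h hh => ?_⟩
    have := setDist_mul_mem_le hsurj hS₁ u hh
    simp only [hf]
    omega
  have hg₂ : ∀ u, OnPath (wordVal A₁) A₂ u → g u = 0 := by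
    intro u hu
    have h0 : setDist H X S₂ u = 0 := setDist_eq_zero hu
    simp [hg, h0]
  have hg₄ : ∀ u, OnPath (wordVal (A₁ ++ A₂ ++ A₃)) A₄ u → g u = d := by
    intro u hu
    have := hfar₂ u hu
    simp only [hg]
    omega
  have hI₂ := cochainHom_eq_zero_of_const f A₂ _ hg₂
  have hI₄ := cochainHom_eq_zero_of_const f A₄ _ hg₄
  have hI₃ : (cochainHom H X f g (wordToF A₃)).integral (wordVal (A₁ ++ A₂)) =
      ((d - 2 : ℕ) : ℤ) * d := by
    rw [cochainHom_eq_of_const (c := ((d - 2 : ℕ) : ℤ)), ← wordVal_append,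
      hg₄ _ (onPath_start _ _), wordVal_append, hg₂ _ (onPath_finish _ _), sub_zero]
    intro u hu
    have h₁ := hfar₁ u hu
    refine ⟨by simp only [hf]; omega, fun l h hh => ?_⟩
    have := setDist_le_mul_mem hsurj hS₁ u hh
    simp only [hf]
    omega
  have hsum : (cochainHom H X f g (wordToF (A₁ ++ A₂ ++ A₃ ++ A₄))).integral 1 =
      ((d - 2 : ℕ) : ℤ) * d := by
    have : (cochainHom H X f g (wordToF (A₁ ++ A₂ ++ A₃ ++ A₄))).integral 1 =
        (cochainHom H X f g (wordToF A₁)).integral 1 +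
        (cochainHom H X f g (wordToF A₂)).integral (wordVal A₁) +
        (cochainHom H X f g (wordToF A₃)).integral (wordVal (A₁ ++ A₂)) +
        (cochainHom H X f g (wordToF A₄)).integral (wordVal (A₁ ++ A₂ ++ A₃)) := by
      simp [wordVal, mul_assoc, add_assoc]
    rw [this, hI₁, hI₂, hI₃, hI₄]
    ring
  have habs := hfill.abs_integral_le hpres (hB f g hfL hgL) 1
  rw [hsum] at habs
  have h₁ : ((d - 2 : ℕ) : ℤ) * d ≤ k * B := (le_abs_self _).trans habs
  have h₂ : (d - 2) * d ≤ k * B := by exact_mod_cast h₁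
  rw [mul_comm] at hlt
  omega

/-- A loop of small relative area has a shortcut whose endpoints divide it into two arcs of length
at least a quarter. -/
lemma exists_shortcut (hpres : IsFiniteRelPres H X R) :
    ∃ B : ℕ, ∀ (w : List (RelLetter H X)) (k d : ℕ), wordVal w = 1 →
      HasFilling R (wordToF w) k → 2 ≤ d → B * k < (d - 2) * d →
      ∃ P Q S t : List (RelLetter H X), w = P ++ Q ++ S ∧ w.length / 4 ≤ Q.length ∧
        w.length / 4 ≤ P.length + S.length ∧ t.length < d ∧ wordVal t = wordVal Q := by
  obtain ⟨B, hB⟩ := exists_short_connection hpres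
  refine ⟨B, fun w k d hloop hfill hd hlt => ?_⟩
  set q := w.length / 4 with hq
  obtain ⟨A₁, A₂, A₃, A₄, rfl, h₁, h₂, h₃, h₄⟩ : ∃ A₁ A₂ A₃ A₄ : List (RelLetter H X),
      w = A₁ ++ A₂ ++ A₃ ++ A₄ ∧ q ≤ A₁.length ∧ q ≤ A₂.length ∧ q ≤ A₃.length ∧
        q ≤ A₄.length := by
    refine ⟨w.take q, (w.drop q).take q, ((w.drop q).drop q).take q, ((w.drop q).drop q).drop q,
      ?_, ?_, ?_, ?_, ?_⟩
    · simp only [List.append_assoc, List.take_append_drop]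
    all_goals simp only [List.length_take, List.length_drop]; omega
  rcases hB A₁ A₂ A₃ A₄ k d hloop hfill hd hlt with
    ⟨u, u', ⟨P, S, rfl, rfl⟩, ⟨P', S', rfl, rfl⟩, t, ht, hval⟩ |
    ⟨u, u', ⟨P, S, rfl, rfl⟩, ⟨P', S', rfl, rfl⟩, t, ht, hval⟩
  · refine ⟨P, S ++ A₂ ++ P', S' ++ A₄, t, by simp, ?_, ?_, ht, ?_⟩
    · simp only [List.length_append] at *; omega
    · simp only [List.length_append] at *; omega
    · simpa [mul_assoc] using hval
  · refine ⟨A₁ ++ P, S ++ A₃ ++ P', S', t, by simp, ?_, ?_, ht, ?_⟩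
    · simp only [List.length_append] at *; omega
    · simp only [List.length_append] at *; omega
    · simpa [mul_assoc] using hval

lemma relArea_le {w : List (RelLetter H X)} {k : ℕ} (h : HasFilling R (wordToF w) k) :
    relArea H X R w ≤ k :=
  Nat.sInf_le h

lemma hasFilling_relArea (hwd : DehnWellDefined H X R) {w : List (RelLetter H X)}
    (hw : wordVal w = 1) : HasFilling R (wordToF w) (relArea H X R w) := by
  obtain ⟨f, hf⟩ := hwd
  obtain ⟨k, -, hk⟩ := hf w hw
  exact Nat.sInf_mem (s := {k | HasFilling R (wordToF w) k}) ⟨k, hk⟩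

/-- The triangle inequality for theta curves. -/
lemma relArea_append_le (hwd : DehnWellDefined H X R) {P Q S t t' : List (RelLetter H X)}
    (hw : wordVal (P ++ Q ++ S) = 1) (ht : wordVal t = wordVal Q)
    (ht' : wordToF t' = (wordToF t)⁻¹) :
    wordVal (Q ++ t') = 1 ∧ wordVal (P ++ t ++ S) = 1 ∧
      relArea H X R (P ++ Q ++ S) ≤ relArea H X R (Q ++ t') + relArea H X R (P ++ t ++ S) := by
  have h₁ : wordVal (Q ++ t') = 1 := by
    rw [wordVal_append, ← ht]
    simp [wordVal, ht']
  have h₂ : wordVal (P ++ t ++ S) = 1 := by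
    simpa [ht] using hw
  refine ⟨h₁, h₂, relArea_le ?_⟩
  have := ((hasFilling_relArea hwd h₁).conj (wordToF P)).mul (hasFilling_relArea hwd h₂)
  convert this using 1
  simp [ht', mul_assoc]

lemma bddAbove_relArea (hwd : DehnWellDefined H X R) (n : ℕ) :
    BddAbove {a | ∃ w : List (RelLetter H X), w.length ≤ n ∧ relEps H X (wordToF w) = 1 ∧
      a = relArea H X R w} := by
  obtain ⟨f, hf⟩ := hwd
  obtain ⟨M, hM⟩ := ((Set.finite_Iic n).image f).bddAbove
  refine ⟨M, ?_⟩
  rintro _ ⟨w, hl, hw, rfl⟩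
  obtain ⟨k, hk, hfill⟩ := hf w hw
  exact (relArea_le hfill).trans (hk.trans (hM ⟨_, hl, rfl⟩))

lemma relArea_le_relDehn (hwd : DehnWellDefined H X R) {w : List (RelLetter H X)} {n : ℕ}
    (hl : w.length ≤ n) (hw : wordVal w = 1) : relArea H X R w ≤ relDehn H X R n :=
  le_csSup (bddAbove_relArea hwd n) ⟨w, hl, hw, rfl⟩

lemma exists_relDehn_eq (hwd : DehnWellDefined H X R) (n : ℕ) :
    ∃ w : List (RelLetter H X), w.length ≤ n ∧ wordVal w = 1 ∧
      relDehn H X R n = relArea H X R w :=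
  Nat.sSup_mem (s := {a | ∃ w : List (RelLetter H X), w.length ≤ n ∧
    relEps H X (wordToF w) = 1 ∧ a = relArea H X R w}) ⟨_, [], by simp, by simp, rfl⟩
    (bddAbove_relArea hwd n)

lemma relDehn_mono (hwd : DehnWellDefined H X R) : Monotone (relDehn H X R) := by
  intro m n hmn
  obtain ⟨w, hl, hw, h⟩ := exists_relDehn_eq hwd m
  rw [h]
  exact relArea_le_relDehn hwd (hl.trans hmn) hw

lemma relDehn_zero (hwd : DehnWellDefined H X R) : relDehn H X R 0 = 0 := by
  obtain ⟨w, hl, -, h⟩ := exists_relDehn_eq hwd 0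
  obtain rfl : w = [] := by simpa using hl
  rw [h]
  exact Nat.le_zero.1 (relArea_le (hasFilling_iff_list.2 ⟨[], by simp⟩))

lemma exists_quarterCut (hpres : IsFiniteRelPres H X R) (hwd : DehnWellDefined H X R) :
    ∃ B : ℕ, QuarterCut B (relDehn H X R) := by
  obtain ⟨B, hB⟩ := exists_shortcut hpres
  refine ⟨B, fun n => ?_⟩
  obtain ⟨w, hl, hw, hn⟩ := exists_relDehn_eq hwd n
  set d := Nat.sqrt (B * relDehn H X R n) + 3 with hd
  have hlt : B * relArea H X R w < (d - 2) * d := by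
    have := Nat.lt_succ_sqrt (B * relDehn H X R n)
    rw [← hn]
    refine this.trans_le (Nat.mul_le_mul ?_ ?_) <;> omega
  obtain ⟨P, Q, S, t, rfl, hQ, hPS, ht, hval⟩ :=
    hB w _ d hw (hasFilling_relArea hwd hw) (by omega) hlt
  obtain ⟨t', htl, ht'⟩ := exists_word_inv t
  obtain ⟨h₁, h₂, h₃⟩ := relArea_append_le hwd hw hval ht'
  refine ⟨(Q ++ t').length, (P ++ t ++ S).length, d, ?_, ?_, ?_, ?_, le_rfl⟩
  · rw [hn]
    exact h₃.trans (add_le_add (relArea_le_relDehn hwd le_rfl h₁)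
      (relArea_le_relDehn hwd le_rfl h₂))
  all_goals simp only [List.length_append] at *; omega

end Cutting

end RelHyp

/-- Corollary 2.54. If `G` is finitely presented relative to `{H_λ}` and the
relative Dehn function `δ^rel` is well-defined, then `δ^rel` is subquadratic (`δ^rel(n) = o(n²)`)
iff it is linear (`δ^rel ⪯ n`). -/
theorem statement_7 {G : Type*} [Group G] {Λ : Type*} (H : Λ → Subgroup G)
    (X : Set G) (R : Set (RelFree H X)) (hpres : IsFiniteRelPres H X R)
    (hwd : DehnWellDefined H X R) :
    (fun n : ℕ => (relDehn H X R n : ℝ)) =o[atTop] (fun n : ℕ => (n : ℝ) ^ 2) ↔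
      AsympLE (relDehn H X R) (fun n => n) := by
  constructor
  · intro hsub
    obtain ⟨B, hB⟩ := exists_quarterCut hpres hwd
    obtain ⟨C, hC⟩ := hB.exists_le_mul (relDehn_mono hwd) (relDehn_zero hwd) hsub
    refine ⟨0, 0, ⌈C⌉₊, fun n => ?_⟩
    have h : (relDehn H X R n : ℝ) ≤ ⌈C⌉₊ * n :=
      (hC n).trans (by gcongr; exact Nat.le_ceil C)
    simpa using (by exact_mod_cast h : relDehn H X R n ≤ ⌈C⌉₊ * n)
  · rintro ⟨C, K, L, h⟩
    have hO : (fun n : ℕ => (relDehn H X R n : ℝ)) =O[atTop] (fun n : ℕ => (n : ℝ)) := by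
      refine IsBigO.of_bound (C * K + L) (Eventually.of_forall fun n => ?_)
      have hn : (relDehn H X R n : ℝ) ≤ C * (K * n) + L * n := by exact_mod_cast h n
      simpa [add_mul, mul_assoc] using hn
    refine hO.trans_isLittleO ?_
    have := (isLittleO_pow_pow_atTop_of_lt (𝕜 := ℝ) one_lt_two).comp_tendsto
      tendsto_natCast_atTop_atTop
    simpa [Function.comp_def] using this
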